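/- arXiv:2011.05432 — 2 statements merged into one kernel-verified Lean document; each statement's English description precedes it below -/
import Mathlib

section
/- Let m ≥ 2 be even and suppose [m]_s = [m]_t = 0 in K. Then π_{t,s} = π_{s,t} in the polynomial ring R = K[α_s, α_t]. -/
open MvPolynomial

/-- The `K`-algebra automorphism `σ` of `R = K[α_s, α_t]` with `σ(α_s) = -α_s` and
`σ(α_t) = α_t + x_s·α_s` (here `α_s = X 0`, `α_t = X 1`). -/
noncomputable def sigP {K : Type*} [CommRing K] (xs : K) :
    MvPolynomial (Fin 2) K →ₐ[K] MvPolynomial (Fin 2) K :=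
  aeval (fun i : Fin 2 => if i = 0 then -X 0 else X 1 + C xs * X 0)

/-- The `K`-algebra automorphism `τ` of `R = K[α_s, α_t]` with `τ(α_s) = α_s + x_t·α_t`
and `τ(α_t) = -α_t`. -/
noncomputable def tauP {K : Type*} [CommRing K] (xt : K) :
    MvPolynomial (Fin 2) K →ₐ[K] MvPolynomial (Fin 2) K :=
  aeval (fun i : Fin 2 => if i = 0 then X 0 + C xt * X 1 else -X 1)

/-- The alternating composite `σ∘τ∘σ∘⋯` of `n` automorphisms, beginning with `σ`. -/
noncomputable def wordST {K : Type*} [CommRing K] (xs xt : K) :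
    ℕ → (MvPolynomial (Fin 2) K →ₐ[K] MvPolynomial (Fin 2) K)
  | 0 => AlgHom.id K _
  | n + 1 => (wordST xs xt n).comp (if Even n then sigP xs else tauP xt)

/-- The alternating composite `τ∘σ∘τ∘⋯` of `n` automorphisms, beginning with `τ`. -/
noncomputable def wordTS {K : Type*} [CommRing K] (xs xt : K) :
    ℕ → (MvPolynomial (Fin 2) K →ₐ[K] MvPolynomial (Fin 2) K)
  | 0 => AlgHom.id K _
  | n + 1 => (wordTS xs xt n).comp (if Even n then tauP xt else sigP xs)

/-- `β_k`: the image of `α_s` (if `k` odd) or `α_t` (if `k` even) under the alternating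
composite of `k-1` automorphisms beginning with `σ`. -/
noncomputable def betaP {K : Type*} [CommRing K] (xs xt : K) (k : ℕ) :
    MvPolynomial (Fin 2) K :=
  wordST xs xt (k - 1) (if Odd k then X 0 else X 1)

/-- `γ_k`: the image of `α_t` (if `k` odd) or `α_s` (if `k` even) under the alternating
composite of `k-1` automorphisms beginning with `τ`. -/
noncomputable def gammaP {K : Type*} [CommRing K] (xs xt : K) (k : ℕ) :
    MvPolynomial (Fin 2) K :=
  wordTS xs xt (k - 1) (if Odd k then X 1 else X 0)

/-- `π_{s,t} = Π_{k=1}^m β_k`. -/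
noncomputable def piST {K : Type*} [CommRing K] (xs xt : K) (m : ℕ) :
    MvPolynomial (Fin 2) K :=
  ∏ k ∈ Finset.range m, betaP xs xt (k + 1)

/-- `π_{t,s} = Π_{k=1}^m γ_k`. -/
noncomputable def piTS {K : Type*} [CommRing K] (xs xt : K) (m : ℕ) :
    MvPolynomial (Fin 2) K :=
  ∏ k ∈ Finset.range m, gammaP xs xt (k + 1)

/-- Two-colored quantum numbers: the two colors agree at odd integers, and at even integers
they become equal after rescaling by the opposite parameter. -/
theorem quantum_parity {K : Type*} [CommRing K] {xs xt : K} {qs qt : ℤ → K}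
    (hqs0 : qs 0 = 0) (hqt0 : qt 0 = 0) (hqs1 : qs 1 = 1) (hqt1 : qt 1 = 1)
    (hrecs : ∀ n : ℤ, qs (n + 1) = xs * qt n - qs (n - 1))
    (hrect : ∀ n : ℤ, qt (n + 1) = xt * qs n - qt (n - 1)) (j : ℕ) :
    xt * qs (2 * j) = xs * qt (2 * j) ∧ qs (2 * j + 1) = qt (2 * j + 1) := by
  induction j with
  | zero => simp [hqs0, hqt0, hqs1, hqt1]
  | succ j ih =>
    obtain ⟨h0, h1⟩ := ih
    have s2 := hrecs (2 * j + 1)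
    have t2 := hrect (2 * j + 1)
    have s3 := hrecs (2 * j + 1 + 1)
    have t3 := hrect (2 * j + 1 + 1)
    rw [add_sub_cancel_right] at s2 t2 s3 t3
    have e : (2 * ((j + 1 : ℕ) : ℤ)) = 2 * j + 1 + 1 := by push_cast; ring
    have h2 : xt * qs (2 * j + 1 + 1) = xs * qt (2 * j + 1 + 1) := by
      rw [s2, t2]
      linear_combination -h0 - xs * xt * h1
    rw [e]
    refine ⟨h2, ?_⟩
    rw [s3, t3]
    linear_combination -h2 - h1

/-- The images of the simple roots `a`, `b` under the alternating composites of two reflections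
`f`, `g` are given by two-colored quantum numbers. -/
theorem alternating_word_apply {K A : Type*} [CommRing K] [CommRing A] [Algebra K A]
    {xs xt : K} {qs qt : ℤ → K}
    (hqs0 : qs 0 = 0) (hqt0 : qt 0 = 0) (hqs1 : qs 1 = 1) (hqt1 : qt 1 = 1)
    (hrecs : ∀ n : ℤ, qs (n + 1) = xs * qt n - qs (n - 1))
    (hrect : ∀ n : ℤ, qt (n + 1) = xt * qs n - qt (n - 1))
    {f g : A →ₐ[K] A} {a b : A} (hfa : f a = -a) (hfb : f b = b + xs • a)
    (hga : g a = a + xt • b) (hgb : g b = -b)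
    {w : ℕ → A →ₐ[K] A} (hw0 : w 0 = AlgHom.id K A)
    (hw : ∀ n, w (n + 1) = (w n).comp (if Even n then f else g)) (n : ℕ) :
    w n (if Even n then a else b) = qs (n + 1) • a + qt n • b ∧
      w n (if Even n then b else a) = -(qs n • a + qt (n - 1) • b) := by
  induction n with
  | zero =>
    have h := hrect 0
    simp only [zero_add, hqt1, hqs0, mul_zero, zero_sub] at h
    have h' : qt (-1) = -1 := by rw [h, neg_neg]
    simp [hw0, hqs0, hqt0, hqs1, h']
  | succ n ih =>
    have s2 := hrecs (n + 1)
    have t2 := hrect n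
    rw [add_sub_cancel_right] at s2
    push_cast
    rw [add_sub_cancel_right, hw]
    rcases Nat.even_or_odd' n with ⟨j, rfl | rfl⟩
    · obtain ⟨h0, h1⟩ := quantum_parity hqs0 hqt0 hqs1 hqt1 hrecs hrect j
      have hp : ¬ Even (2 * j + 1) := by simp
      simp only [even_two_mul, if_true, if_neg hp] at ih ⊢
      push_cast at ih s2 t2 ⊢
      obtain ⟨iha, ihb⟩ := ih
      simp only [AlgHom.comp_apply, hfa, hfb, map_add, map_neg, map_smul, iha, ihb]
      refine ⟨?_, trivial⟩
      rw [s2, h1, t2, h0]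
      module
    · obtain ⟨-, h1⟩ := quantum_parity hqs0 hqt0 hqs1 hqt1 hrecs hrect j
      obtain ⟨h0, -⟩ := quantum_parity hqs0 hqt0 hqs1 hqt1 hrecs hrect (j + 1)
      have hp : ¬ Even (2 * j + 1) := by simp
      have hp' : Even (2 * j + 1 + 1) := ⟨j + 1, by ring⟩
      have e : (2 * ((j + 1 : ℕ) : ℤ)) = 2 * j + 1 + 1 := by push_cast; ring
      rw [e] at h0
      simp only [if_pos hp', if_neg hp] at ih ⊢
      push_cast at ih s2 t2 ⊢
      obtain ⟨iha, ihb⟩ := ih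
      simp only [AlgHom.comp_apply, hga, hgb, map_add, map_neg, map_smul, iha, ihb]
      refine ⟨?_, trivial⟩
      rw [s2, ← h0, t2, h1]
      module

/-- If both quantum numbers vanish at `m`, then they are antisymmetric about `m`, up to a scalar,
as soon as they agree at `m - 1`. -/
theorem quantum_reflect {K : Type*} [CommRing K] {xs xt u : K} {qs qt : ℤ → K}
    (hqs0 : qs 0 = 0) (hqt0 : qt 0 = 0) (hqs1 : qs 1 = 1) (hqt1 : qt 1 = 1)
    (hrecs : ∀ n : ℤ, qs (n + 1) = xs * qt n - qs (n - 1))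
    (hrect : ∀ n : ℤ, qt (n + 1) = xt * qs n - qt (n - 1))
    {m : ℤ} (hms : qs m = 0) (hmt : qt m = 0) (hus : qs (m - 1) = u) (hut : qt (m - 1) = u)
    (k : ℕ) :
    (qs (m - k) = u * qs k ∧ qt (m - k) = u * qt k) ∧
      qs (m - (k + 1)) = u * qs (k + 1) ∧ qt (m - (k + 1)) = u * qt (k + 1) := by
  induction k with
  | zero => simp [hms, hmt, hqs0, hqt0, hqs1, hqt1, hus, hut]
  | succ k ih =>
    obtain ⟨⟨hs0, ht0⟩, hs1, ht1⟩ := ih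
    have s := hrecs (k + 1)
    have t := hrect (k + 1)
    have s' := hrecs (m - (k + 1))
    have t' := hrect (m - (k + 1))
    rw [add_sub_cancel_right] at s t
    rw [show m - (k + 1 : ℤ) + 1 = m - k by ring,
      show m - (k + 1 : ℤ) - 1 = m - (k + 1 + 1) by ring] at s' t'
    push_cast
    refine ⟨⟨hs1, ht1⟩, ?_, ?_⟩
    · linear_combination s' - hs0 + xs * ht1 - u * s
    · linear_combination t' - ht0 + xt * hs1 - u * t

/-- If `m ≥ 2` is even and `[m]_s = [m]_t = 0` in `K`, then `π_{t,s} = π_{s,t}`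
in `R = K[α_s, α_t]`. -/
theorem piTS_eq_piST_of_even {K : Type*} [CommRing K] (xs xt : K) (qs qt : ℤ → K)
    (hqs0 : qs 0 = 0) (hqt0 : qt 0 = 0) (hqs1 : qs 1 = 1) (hqt1 : qt 1 = 1)
    (hrecs : ∀ n : ℤ, qs (n + 1) = xs * qt n - qs (n - 1))
    (hrect : ∀ n : ℤ, qt (n + 1) = xt * qs n - qt (n - 1))
    (m : ℕ) (hm : 2 ≤ m) (hme : Even m) (hms : qs (m : ℤ) = 0) (hmt : qt (m : ℤ) = 0) :
    piTS xs xt m = piST xs xt m := by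
  have hβ (k : ℕ) : betaP xs xt (k + 1) =
      qs (k + 1) • (X 0 : MvPolynomial (Fin 2) K) + qt k • X 1 := by
    rw [← (alternating_word_apply hqs0 hqt0 hqs1 hqt1 hrecs hrect (f := sigP xs) (g := tauP xt)
      (a := X 0) (b := X 1) (by simp [sigP]) (by simp [sigP, smul_eq_C_mul])
      (by simp [tauP, smul_eq_C_mul]) (by simp [tauP]) (w := wordST xs xt) rfl
      (fun _ => rfl) k).1]
    simp [betaP, Nat.odd_add_one]
  have hγ (k : ℕ) : gammaP xs xt (k + 1) =
      qt (k + 1) • (X 1 : MvPolynomial (Fin 2) K) + qs k • X 0 := by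
    rw [← (alternating_word_apply hqt0 hqs0 hqt1 hqs1 hrect hrecs (f := tauP xt) (g := sigP xs)
      (a := X 1) (b := X 0) (by simp [tauP]) (by simp [tauP, smul_eq_C_mul])
      (by simp [sigP, smul_eq_C_mul]) (by simp [sigP]) (w := wordTS xs xt) rfl
      (fun _ => rfl) k).1]
    simp [gammaP, Nat.odd_add_one]
  have hu : qt ((m : ℤ) - 1) = qs (m - 1) := by
    obtain ⟨j, rfl⟩ : ∃ j, m = 2 * (j + 1) := by
      obtain ⟨r, rfl⟩ := hme
      exact ⟨r - 1, by omega⟩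
    have h := (quantum_parity hqs0 hqt0 hqs1 hqt1 hrecs hrect j).2
    rw [show ((2 * (j + 1) : ℕ) : ℤ) - 1 = 2 * j + 1 by push_cast; ring, h]
  have hrefl := quantum_reflect hqs0 hqt0 hqs1 hqt1 hrecs hrect hms hmt rfl hu
  have hsq : qs ((m : ℤ) - 1) ^ 2 = 1 := by
    have h := (hrefl (m - 1)).1.1
    rw [Nat.cast_sub (by omega), Nat.cast_one, sub_sub_cancel, hqs1] at h
    rw [sq, ← h]
  have hpow : qs ((m : ℤ) - 1) ^ m = 1 := by
    obtain ⟨r, hr⟩ := hme.two_dvd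
    conv_lhs => rw [hr, pow_mul, ← hr, hsq, one_pow]
  have hterm : ∀ k ∈ Finset.range m,
      gammaP xs xt (m - 1 - k + 1) = C (qs ((m : ℤ) - 1)) * betaP xs xt (k + 1) := by
    intro k hk
    have hk' := Finset.mem_range.mp hk
    obtain ⟨⟨-, ht⟩, hs, -⟩ := hrefl k
    have e : ((m - 1 - k : ℕ) : ℤ) = m - (k + 1) := by omega
    rw [hγ, hβ, e, show (m : ℤ) - (k + 1) + 1 = m - k by ring, ht, hs, ← smul_eq_C_mul]
    module
  rw [piTS, piST, ← Finset.prod_range_reflect, Finset.prod_congr rfl hterm,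
    Finset.prod_mul_distrib, Finset.prod_const, Finset.card_range, ← C_pow, hpow, C_1, one_mul]
end

section
/- Let m ≥ 1 be odd and suppose [m]_s = [m]_t = 0 in K. Then π_{s,t} is anti-invariant: σ(π_{s,t}) = −π_{s,t} and τ(π_{s,t}) = −π_{s,t} in the polynomial ring R = K[α_s, α_t]. -/
open MvPolynomial

section Reflections

variable {K : Type*} [CommRing K] (xs xt : K)

@[simp] lemma sigP_X_zero : sigP xs (X 0) = -X 0 := by simp [sigP]

@[simp] lemma sigP_X_one : sigP xs (X 1) = X 1 + C xs * X 0 := by simp [sigP]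

@[simp] lemma tauP_X_zero : tauP xt (X 0) = X 0 + C xt * X 1 := by simp [tauP]

@[simp] lemma tauP_X_one : tauP xt (X 1) = -X 1 := by simp [tauP]

/-- The root `β_{2i+1}`. -/
noncomputable def oddRoot (i : ℕ) : MvPolynomial (Fin 2) K := wordST xs xt (2 * i) (X 0)

/-- The root `β_{2i}`, with the convention `β_0 = -α_t`. -/
noncomputable def evenRoot (i : ℕ) : MvPolynomial (Fin 2) K := -wordST xs xt (2 * i) (X 1)

@[simp] lemma oddRoot_zero : oddRoot xs xt 0 = X 0 := by simp [oddRoot, wordST]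

@[simp] lemma evenRoot_zero : evenRoot xs xt 0 = -X 1 := by simp [evenRoot, wordST]

lemma wordST_two_mul_succ (i : ℕ) (p : MvPolynomial (Fin 2) K) :
    wordST xs xt (2 * (i + 1)) p = wordST xs xt (2 * i) (sigP xs (tauP xt p)) := by
  have h : ¬ Even (2 * i + 1) := by simp
  simp [mul_add, wordST, h]

lemma evenRoot_succ (i : ℕ) :
    evenRoot xs xt (i + 1) = C xs * oddRoot xs xt i - evenRoot xs xt i := by
  simp only [evenRoot, oddRoot, wordST_two_mul_succ, tauP_X_one, sigP_X_one, map_neg, map_add,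
    map_mul, algHom_C, algebraMap_eq]
  ring

lemma oddRoot_succ (i : ℕ) :
    oddRoot xs xt (i + 1) = C xt * evenRoot xs xt (i + 1) - oddRoot xs xt i := by
  simp only [evenRoot, oddRoot, wordST_two_mul_succ, tauP_X_one, tauP_X_zero, sigP_X_zero,
    sigP_X_one, map_neg, map_add, map_mul, algHom_C, algebraMap_eq]
  ring

lemma betaP_two_mul_add_one (i : ℕ) : betaP xs xt (2 * i + 1) = oddRoot xs xt i := by
  simp [betaP, oddRoot]

lemma betaP_two_mul_add_two (i : ℕ) : betaP xs xt (2 * i + 2) = evenRoot xs xt (i + 1) := by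
  have h : ¬ Odd (2 * i + 2) := by simp [parity_simps]
  rw [evenRoot_succ]
  simp [betaP, oddRoot, evenRoot, wordST, h]
  ring

lemma piST_two_mul_add_one (n : ℕ) :
    piST xs xt (2 * n + 1) =
      (∏ i ∈ Finset.range n, oddRoot xs xt i * evenRoot xs xt (i + 1)) * oddRoot xs xt n := by
  induction n with
  | zero => simp [piST, ← betaP_two_mul_add_one]
  | succ n ih =>
    have h : piST xs xt (2 * (n + 1) + 1) =
        piST xs xt (2 * n + 1) * betaP xs xt (2 * n + 2) * betaP xs xt (2 * (n + 1) + 1) := by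
      simp [piST, mul_add, Finset.prod_range_succ]
    rw [h, ih, betaP_two_mul_add_two, betaP_two_mul_add_one, Finset.prod_range_succ]
    ring

lemma piST_two_mul_add_one' (n : ℕ) :
    piST xs xt (2 * n + 1) =
      X 0 * ∏ i ∈ Finset.range n, evenRoot xs xt (i + 1) * oddRoot xs xt (i + 1) := by
  rw [piST_two_mul_add_one, Finset.prod_mul_distrib, Finset.prod_mul_distrib, mul_right_comm,
    ← Finset.prod_range_succ, Finset.prod_range_succ', oddRoot_zero]
  ring

/-- An algebra endomorphism that reverses the root sequence, up to scalars, at its start does so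
throughout. -/
lemma map_roots_of_reverses {c d : K} (hcd : xs * c = xt * d)
    (φ : MvPolynomial (Fin 2) K →ₐ[K] MvPolynomial (Fin 2) K) (N : ℕ)
    (he : φ (evenRoot xs xt 0) = C d * oddRoot xs xt N)
    (ho : φ (oddRoot xs xt 0) = C c * evenRoot xs xt N) (i j : ℕ) (hij : i + j = N) :
    φ (evenRoot xs xt i) = C d * oddRoot xs xt j ∧
      φ (oddRoot xs xt i) = C c * evenRoot xs xt j := by
  have hC : (C xs * C c : MvPolynomial (Fin 2) K) = C xt * C d := by
    rw [← C_mul, ← C_mul, hcd]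
  induction i generalizing j with
  | zero =>
    obtain rfl : j = N := by omega
    exact ⟨he, ho⟩
  | succ i ih =>
    obtain ⟨h₁, h₂⟩ := ih (j + 1) (by omega)
    have h₃ : φ (evenRoot xs xt (i + 1)) = C d * oddRoot xs xt j := by
      rw [evenRoot_succ, map_sub, map_mul, h₁, h₂, algHom_C, algebraMap_eq, oddRoot_succ]
      linear_combination evenRoot xs xt (j + 1) * hC
    refine ⟨h₃, ?_⟩
    rw [oddRoot_succ, map_sub, map_mul, h₃, h₂, algHom_C, algebraMap_eq, evenRoot_succ]
    linear_combination -oddRoot xs xt j * hC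

end Reflections

section QuantumNumbers

variable {K : Type*} [CommRing K] {xs xt : K} {qs qt : ℤ → K}

lemma roots_eq_quantum (hqs0 : qs 0 = 0) (hqt0 : qt 0 = 0) (hqs1 : qs 1 = 1) (hqt1 : qt 1 = 1)
    (hrecs : ∀ n : ℤ, qs (n + 1) = xs * qt n - qs (n - 1))
    (hrect : ∀ n : ℤ, qt (n + 1) = xt * qs n - qt (n - 1)) (i : ℕ) :
    evenRoot xs xt i = C (qs (2 * i)) * X 0 + C (qs (2 * i - 1)) * X 1 ∧
      oddRoot xs xt i = C (qt (2 * i + 1)) * X 0 + C (qt (2 * i)) * X 1 ∧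
      xs * qt (2 * i) = xt * qs (2 * i) ∧ qs (2 * i - 1) = qt (2 * i - 1) ∧
      qs (2 * i) * qt (2 * i) - qs (2 * i - 1) * qt (2 * i + 1) = 1 := by
  induction i with
  | zero =>
    have h₁ : qs (-1) = -1 := by
      have := hrecs 0
      simp only [zero_add, zero_sub, hqt0, hqs1] at this
      linear_combination this
    have h₂ : qt (-1) = -1 := by
      have := hrect 0
      simp only [zero_add, zero_sub, hqs0, hqt1] at this
      linear_combination this
    simp [hqs0, hqt0, hqt1, h₁, h₂]
  | succ i ih =>
    obtain ⟨he, ho, hx, hodd, hdet⟩ := ih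
    have s₁ := hrecs (2 * i)
    have t₁ := hrect (2 * i)
    have s₂ := hrecs (2 * i + 1)
    have t₂ := hrect (2 * i + 1)
    have t₃ := hrect (2 * i + 2)
    rw [show (2 * i + 1 + 1 : ℤ) = 2 * i + 2 by ring, add_sub_cancel_right] at s₂ t₂
    rw [show (2 * i + 2 + 1 : ℤ) = 2 * i + 3 by ring,
      show (2 * i + 2 - 1 : ℤ) = 2 * i + 1 by ring] at t₃
    have hodd' : qs (2 * i + 1) = qt (2 * i + 1) := by
      linear_combination s₁ - t₁ + hx - hodd
    have hE : evenRoot xs xt (i + 1) = C (qs (2 * i + 2)) * X 0 + C (qs (2 * i + 1)) * X 1 := by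
      rw [evenRoot_succ, he, ho, s₁, s₂]
      simp only [C_sub, C_mul]
      ring
    push_cast
    rw [show (2 * (i + 1) : ℤ) = 2 * i + 2 by ring,
      show (2 * i + 2 + 1 : ℤ) = 2 * i + 3 by ring,
      show (2 * i + 2 - 1 : ℤ) = 2 * i + 1 by ring]
    refine ⟨hE, ?_, ?_, hodd', ?_⟩
    · rw [oddRoot_succ, hE, ho, t₃, t₂]
      simp only [C_sub, C_mul]
      ring
    · linear_combination xs * t₂ - xt * s₂ + xs * xt * hodd' - hx
    · rw [t₃, t₂, s₂, hodd']
      linear_combination hdet + qt (2 * i + 1) * (s₁ - hodd')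

end QuantumNumbers

/-- If `m ≥ 1` is odd and `[m]_s = [m]_t = 0` in `K`, then `π_{s,t}` is
anti-invariant: `σ(π_{s,t}) = -π_{s,t}` and `τ(π_{s,t}) = -π_{s,t}`. -/
theorem piST_antiinvariant_of_odd {K : Type*} [CommRing K] (xs xt : K) (qs qt : ℤ → K)
    (hqs0 : qs 0 = 0) (hqt0 : qt 0 = 0) (hqs1 : qs 1 = 1) (hqt1 : qt 1 = 1)
    (hrecs : ∀ n : ℤ, qs (n + 1) = xs * qt n - qs (n - 1))
    (hrect : ∀ n : ℤ, qt (n + 1) = xt * qs n - qt (n - 1))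
    (m : ℕ) (hm : 1 ≤ m) (hmo : Odd m) (hms : qs (m : ℤ) = 0) (hmt : qt (m : ℤ) = 0) :
    sigP xs (piST xs xt m) = -piST xs xt m ∧ tauP xt (piST xs xt m) = -piST xs xt m := by
  obtain ⟨n, rfl⟩ := hmo
  push_cast at hms hmt
  obtain ⟨he, ho, hx, -, hdet⟩ := roots_eq_quantum hqs0 hqt0 hqs1 hqt1 hrecs hrect n
  have hs := hrecs (2 * n)
  rw [hms] at hs
  rw [hmt, mul_zero, sub_zero] at hdet
  rw [hmt, C_0, zero_mul, zero_add] at ho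
  rw [show qs (2 * n - 1) = xs * qt (2 * n) by linear_combination hs] at he
  generalize qt (2 * n) = c at *
  generalize qs (2 * n) = d at *
  have hC : (C d * C c : MvPolynomial (Fin 2) K) = 1 := by rw [← C_mul, hdet, C_1]
  have hxC : (C xs * C c : MvPolynomial (Fin 2) K) = C xt * C d := by
    rw [← C_mul, ← C_mul, hx]
  rw [C_mul] at he
  have he' : evenRoot xs xt (n + 1) = -(C d * X 0) := by
    rw [evenRoot_succ, he, ho]
    ring
  have ho' : oddRoot xs xt (n + 1) = -(C c * (X 1 + C xs * X 0)) := by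
    rw [oddRoot_succ, he', ho]
    linear_combination X 0 * hxC
  have hsig := map_roots_of_reverses xs xt hx (sigP xs) (n + 1)
    (by rw [evenRoot_zero, ho', map_neg, sigP_X_one]
        linear_combination (X 1 + C xs * X 0) * hC)
    (by rw [oddRoot_zero, he', sigP_X_zero]
        linear_combination X 0 * hC)
  have htau := map_roots_of_reverses xs xt hx (tauP xt) n
    (by rw [evenRoot_zero, ho, map_neg, tauP_X_one]
        linear_combination -X 1 * hC)
    (by rw [oddRoot_zero, he, tauP_X_zero]
        linear_combination -(X 0 + C xt * X 1) * hC - C c * X 1 * hxC)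
  constructor
  · rw [piST_two_mul_add_one', map_mul, map_prod, sigP_X_zero, neg_mul]
    congr 2
    rw [← Finset.prod_range_reflect (fun i => evenRoot xs xt (i + 1) * oddRoot xs xt (i + 1))]
    refine Finset.prod_congr rfl fun i hi => ?_
    have hi' := Finset.mem_range.mp hi
    obtain ⟨h₁, h₂⟩ := hsig (i + 1) (n - 1 - i + 1) (by omega)
    rw [map_mul, h₁, h₂]
    linear_combination evenRoot xs xt (n - 1 - i + 1) * oddRoot xs xt (n - 1 - i + 1) * hC
  · rw [piST_two_mul_add_one, map_mul, map_prod, ho, map_mul, tauP_X_one, algHom_C,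
      algebraMap_eq, mul_neg, mul_neg]
    congr 2
    rw [← Finset.prod_range_reflect (fun i => oddRoot xs xt i * evenRoot xs xt (i + 1))]
    refine Finset.prod_congr rfl fun i hi => ?_
    have hi' := Finset.mem_range.mp hi
    have h₁ := (htau i (n - 1 - i + 1) (by omega)).2
    have h₂ := (htau (i + 1) (n - 1 - i) (by omega)).1
    rw [map_mul, h₁, h₂]
    linear_combination oddRoot xs xt (n - 1 - i) * evenRoot xs xt (n - 1 - i + 1) * hC
end
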